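/- Let β>0, 1<p<∞, and 1≤q,τ≤∞, and assume μ satisfies the quantitative reverse doubling condition for some exponent σ>β. Then there exists a constant C=C(c_σ,c_μ,β,σ,p)>0, independent of q and τ, such that Cp^β_{p,q}(E) ≤ C·Cp^β_{p,τ}(E) for all compact sets E⊂X. -/

import Mathlib

open MeasureTheory Metric Set
open scoped ENNReal NNReal

noncomputable section

namespace TLCap

variable {X : Type*} [MetricSpace X] [MeasurableSpace X] [BorelSpace X]

/-- `validIdx X n` means `n ≥ n₀`, i.e. `2^{-n} ≤ 2 diam X`;
all `n : ℤ` are valid when `X` is unbounded. -/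
def validIdx (X : Type*) [PseudoMetricSpace X] (n : ℤ) : Prop :=
  ENNReal.ofReal ((2 : ℝ) ^ (-n)) ≤ 2 * EMetric.diam (Set.univ : Set X)

/-- The doubling condition for `μ`, with doubling constant `c`. -/
def IsDoubling (μ : Measure X) (c : ℝ≥0∞) : Prop :=
  ∀ (x : X) (r : ℝ), 0 < r → μ (ball x (2 * r)) ≤ c * μ (ball x r)

/-- The reverse doubling condition with constant `c`. -/
def IsReverseDoubling (μ : Measure X) (c : ℝ≥0∞) : Prop :=
  ∀ (x : X) (r : ℝ), 0 < r → 2 * ENNReal.ofReal r < EMetric.diam (Set.univ : Set X) →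
    μ (ball x (r / 2)) ≤ c * μ (ball x r)

/-- The quantitative reverse doubling condition with exponent `σ` and constant `c`. -/
def IsQRD (μ : Measure X) (σ : ℝ) (c : ℝ≥0∞) : Prop :=
  ∀ (x : X) (r R : ℝ), 0 < r → r < R →
    ENNReal.ofReal R ≤ 2 * EMetric.diam (Set.univ : Set X) →
    μ (ball x r) ≤ c * ENNReal.ofReal ((r / R) ^ σ) * μ (ball x R)

open Classical in
/-- The `l^q` norm of a sequence of extended nonnegative reals (`q = ∞` allowed). -/
def lqNorm (q : ℝ≥0∞) (a : ℤ → ℝ≥0∞) : ℝ≥0∞ :=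
  if q = ∞ then ⨆ k, a k else (∑' k, a k ^ q.toReal) ^ (1 / q.toReal)

/-- The mixed norm `‖g‖_{L^p(Ω; l^q)}`. -/
def mixedNorm (μ : Measure X) (Ω : Set X) (p : ℝ) (q : ℝ≥0∞) (g : ℤ → X → ℝ≥0∞) : ℝ≥0∞ :=
  (∫⁻ x in Ω, lqNorm q (fun k => g k x) ^ p ∂μ) ^ (1 / p)

/-- `g = (g_k)_{k ∈ ℤ}` is a fractional `β`-Hajłasz gradient of `u` on `Ω`. -/
def IsFracGrad (μ : Measure X) (β : ℝ) (Ω : Set X) (u : X → ℝ) (g : ℤ → X → ℝ≥0∞) : Prop :=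
  (∀ k, Measurable (g k)) ∧
  ∃ N : Set X, N ⊆ Ω ∧ μ N = 0 ∧
    ∀ (k : ℤ), ∀ x ∈ Ω \ N, ∀ y ∈ Ω \ N,
      (2 : ℝ) ^ (-k - 1) ≤ dist x y → dist x y < (2 : ℝ) ^ (-k) →
      ENNReal.ofReal |u x - u y| ≤ ENNReal.ofReal (dist x y ^ β) * (g k x + g k y)

/-- The homogeneous Hajłasz–Triebel–Lizorkin seminorm `|u|_{Ṁ^β_{p,q}(Ω)}`. -/
def htlSeminorm (μ : Measure X) (β p : ℝ) (q : ℝ≥0∞) (Ω : Set X) (u : X → ℝ) : ℝ≥0∞ :=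
  ⨅ g : {g : ℤ → X → ℝ≥0∞ // IsFracGrad μ β Ω u g}, mixedNorm μ Ω p q g.1

/-- The relative Hajłasz–Triebel–Lizorkin capacity `cap^β_{p,q}(E, 2B, ΛB)`,
where `B = B(x₀, r)`. -/
def relCap (μ : Measure X) (β p : ℝ) (q : ℝ≥0∞) (E : Set X) (x₀ : X) (r Λ : ℝ) : ℝ≥0∞ :=
  ⨅ φ : {φ : X → ℝ // Continuous φ ∧ (∀ x ∈ E, 1 ≤ φ x) ∧ ∀ x ∉ ball x₀ (2 * r), φ x = 0},
    htlSeminorm μ β p q (ball x₀ (Λ * r)) φ.1 ^ p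

open Classical in
/-- The potential `H_β f`. -/
def Hpot (μ : Measure X) (β : ℝ) (f : ℤ → X → ℝ≥0∞) (x : X) : ℝ≥0∞ :=
  ∑' n : ℤ, if validIdx X n then
    (2 : ℝ≥0∞) ^ (-β * (n : ℝ)) *
      ∫⁻ y, (ball y ((2 : ℝ) ^ (-n))).indicator (fun _ => (1 : ℝ≥0∞)) x * f n y /
        μ (ball y ((2 : ℝ) ^ (-n))) ∂μ
  else 0

/-- A sequence `(f_n)_{n ≥ n₀}` of nonnegative Borel functions, realized as a sequence
indexed by `ℤ` vanishing at invalid indices. -/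
def IsAdmissibleSeq (f : ℤ → X → ℝ≥0∞) : Prop :=
  (∀ n, Measurable (f n)) ∧ ∀ n, ¬ validIdx X n → f n = 0

/-- The Triebel–Lizorkin `(β,p,q)`-capacity `Cp^β_{p,q}(E)`. -/
def CpCap (μ : Measure X) (β p : ℝ) (q : ℝ≥0∞) (E : Set X) : ℝ≥0∞ :=
  ⨅ f : {f : ℤ → X → ℝ≥0∞ // IsAdmissibleSeq f ∧ ∀ x ∈ E, 1 ≤ Hpot μ β f x},
    mixedNorm μ Set.univ p q f.1 ^ p

open Classical in
/-- The sequence `Ȟ_β ν`. -/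
def Hcheck (μ ν : Measure X) (β : ℝ) : ℤ → X → ℝ≥0∞ := fun n x =>
  if validIdx X n then
    (2 : ℝ≥0∞) ^ (-β * (n : ℝ)) * ν (ball x ((2 : ℝ) ^ (-n))) / μ (ball x ((2 : ℝ) ^ (-n)))
  else 0

/-- `ν` is a nonnegative Radon measure on the (compact) set `E`. -/
def IsRadonOn (ν : Measure X) (E : Set X) : Prop :=
  ν Eᶜ = 0 ∧ ν E ≠ ∞ ∧
  (∀ F : Set X, MeasurableSet F → F ⊆ E →
    ν F = ⨅ (U : Set X) (_ : IsOpen U) (_ : F ⊆ U ∩ E), ν (U ∩ E)) ∧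
  (∀ F : Set X, MeasurableSet F → F ⊆ E →
    ν F = ⨆ (K : Set X) (_ : IsCompact K) (_ : K ⊆ F), ν K)

open Classical in
/-- The conjugate exponent, with `1' = ∞` and `∞' = 1`. -/
def conjExp (q : ℝ≥0∞) : ℝ≥0∞ :=
  if q = 1 then ∞ else if q = ∞ then 1 else ENNReal.ofReal (q.toReal / (q.toReal - 1))

/-- `2^{-n₀}` (equal to `∞` when `X` is unbounded). -/
def radMax (X : Type*) [PseudoMetricSpace X] : ℝ≥0∞ :=
  ⨆ (n : ℤ) (_ : validIdx X n), ENNReal.ofReal ((2 : ℝ) ^ (-n))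

/-- The fractional maximal function `M_β ν`. -/
def fracMax (μ ν : Measure X) (β : ℝ) (x : X) : ℝ≥0∞ :=
  ⨆ (r : ℝ) (_ : 0 < r) (_ : ENNReal.ofReal r ≤ radMax X),
    ENNReal.ofReal (r ^ β) * ν (ball x r) / μ (ball x r)

/-- The Riesz potential `I_β ν` of a nonnegative Borel measure. -/
def rieszPot (μ ν : Measure X) (β : ℝ) (x : X) : ℝ≥0∞ :=
  ∫⁻ y in {x}ᶜ, ENNReal.ofReal (dist x y ^ β) / μ (ball x (dist x y)) ∂ν

/-- The Riesz `(β,p)`-capacity `R_{β,p}(E)`. -/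
def rieszCap (μ : Measure X) (β p : ℝ) (E : Set X) : ℝ≥0∞ :=
  ⨅ f : {f : X → ℝ≥0∞ // Measurable f ∧ ∀ x ∈ E, 1 ≤ rieszPot μ (μ.withDensity f) β x},
    ∫⁻ x, f.1 x ^ p ∂μ

/-- The `ρ`-restricted Hausdorff content of codimension `d`. -/
def hContent (μ : Measure X) (d : ℝ) (ρ : ℝ≥0∞) (F : Set X) : ℝ≥0∞ :=
  ⨅ c : {c : ℕ → X × ℝ //
      (∀ k, 0 < (c k).2 ∧ ENNReal.ofReal (c k).2 ≤ ρ) ∧ F ⊆ ⋃ k, ball (c k).1 (c k).2},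
    ∑' k, μ (ball (c.1 k).1 (c.1 k).2) * ENNReal.ofReal ((c.1 k).2 ^ (-d))

/-- Partition of unity data at every valid scale: the balls `B(x_{n,i}, 2^{-n-1})` are pairwise
disjoint, the balls `B(x_{n,i}, 2^{-n})` cover `X`, and `ψ_{n,i}` is the associated
partition of unity with constants `κ` and `L`. -/
def IsPartition {ι : ℤ → Type*} (pt : ∀ n, ι n → X)
    (ψ : ∀ n, ι n → X → ℝ) (κ L : ℝ) : Prop :=
  ∀ n : ℤ, validIdx X n →
    (∀ i j : ι n, i ≠ j →
        Disjoint (ball (pt n i) ((2:ℝ) ^ (-n - 1))) (ball (pt n j) ((2:ℝ) ^ (-n - 1)))) ∧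
    (∀ x : X, ∃ i : ι n, x ∈ ball (pt n i) ((2:ℝ) ^ (-n))) ∧
    (∀ (i : ι n) (x : X), 0 ≤ ψ n i x ∧ ψ n i x ≤ 1) ∧
    (∀ (i : ι n), ∀ x ∉ ball (pt n i) (6 * (2:ℝ) ^ (-n)), ψ n i x = 0) ∧
    (∀ (i : ι n), ∀ x ∈ ball (pt n i) (3 * (2:ℝ) ^ (-n)), κ ≤ ψ n i x) ∧
    (∀ i : ι n, LipschitzWith (Real.toNNReal ((2:ℝ) ^ n * L)) (ψ n i)) ∧
    (∀ x : X, HasSum (fun i : ι n => ψ n i x) 1)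

open Classical in
/-- The discrete potential `L_β f`. -/
def discPot {ι : ℤ → Type*} (μ : Measure X) (β : ℝ) (pt : ∀ n, ι n → X)
    (ψ : ∀ n, ι n → X → ℝ) (f : ℤ → X → ℝ≥0∞) (x : X) : ℝ≥0∞ :=
  ∑' n : ℤ, if validIdx X n then
    (2 : ℝ≥0∞) ^ (-β * (n : ℝ)) *
      ∑' i : ι n, ENNReal.ofReal (ψ n i x) *
        ((∫⁻ y in ball (pt n i) (3 * (2:ℝ) ^ (-n)), f n y ∂μ) /
          μ (ball (pt n i) (3 * (2:ℝ) ^ (-n))))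
  else 0

/-- A geodesic metric space: any two points are joined by an isometric image of an interval. -/
def IsGeodesicSpace (X : Type*) [MetricSpace X] : Prop :=
  ∀ x y : X, ∃ γ : ℝ → X, γ 0 = x ∧ γ (dist x y) = y ∧
    ∀ s ∈ Set.Icc (0:ℝ) (dist x y), ∀ t ∈ Set.Icc (0:ℝ) (dist x y),
      dist (γ s) (γ t) = |s - t|

/-- The Hajłasz–Triebel–Lizorkin `(β,p,q)`-capacity density condition with
constants `c₀, c₁, Λ`. -/
def HTLDensity (μ : Measure X) (β p : ℝ) (q : ℝ≥0∞) (E : Set X) (c₀ c₁ Λ : ℝ) : Prop :=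
  ∀ x ∈ E, ∀ r : ℝ, 0 < r → ENNReal.ofReal r < ENNReal.ofReal c₁ * EMetric.diam E →
    ENNReal.ofReal c₀ * relCap μ β p q (closure (ball x r)) x r Λ ≤
      relCap μ β p q (E ∩ closure (ball x r)) x r Λ

/-- The Riesz `(β,p)`-capacity density condition with constant `c₀`. -/
def RieszDensity (μ : Measure X) (β p : ℝ) (E : Set X) (c₀ : ℝ) : Prop :=
  ∀ x ∈ E, ∀ r : ℝ, 0 < r → ENNReal.ofReal (8 * r) < EMetric.diam E →
    ENNReal.ofReal c₀ * rieszCap μ β p (closure (ball x r)) ≤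
      rieszCap μ β p (E ∩ closure (ball x r))

/-- The Hausdorff content density condition of codimension `d` with constant `c₀`. -/
def HausdorffDensity (μ : Measure X) (d : ℝ) (E : Set X) (c₀ : ℝ) : Prop :=
  ∀ x ∈ E, ∀ r : ℝ, 0 < r → ENNReal.ofReal r < EMetric.diam E →
    ENNReal.ofReal c₀ * hContent μ d (ENNReal.ofReal r) (closure (ball x r)) ≤
      hContent μ d (ENNReal.ofReal r) (E ∩ closure (ball x r))

/-! ### Averages against a slowly varying kernel -/

/-- The average of `F` at scale `2^{-m}` with the kernel `(1 + δ 2^m d(x, z))^{-L}`. -/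
def slowAvg (μ : Measure X) (δ : ℝ) (L : ℕ) (F : X → ℝ≥0∞) (m : ℤ) (x : X) : ℝ≥0∞ :=
  ∫⁻ z, ENNReal.ofReal (((1 + δ * (2 ^ m * dist x z))⁻¹) ^ L) *
    (F z / μ (ball z ((2 : ℝ) ^ (-m)))) ∂μ

/-- The average of `f` at scale `2^{-n}` appearing in the potential `Hpot`. -/
def ballAvg (μ : Measure X) (n : ℤ) (f : X → ℝ≥0∞) (x : X) : ℝ≥0∞ :=
  ∫⁻ y, (ball y ((2 : ℝ) ^ (-n))).indicator (fun _ => (1 : ℝ≥0∞)) x * f y /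
    μ (ball y ((2 : ℝ) ^ (-n))) ∂μ

omit [BorelSpace X] in
lemma slowAvg_le_mul (μ : Measure X) {δ : ℝ} (hδ : 0 ≤ δ) (L : ℕ) (F : X → ℝ≥0∞) (m : ℤ)
    (x y : X) :
    slowAvg μ δ L F m x ≤
      ENNReal.ofReal ((1 + δ * (2 ^ m * dist x y)) ^ L) * slowAvg μ δ L F m y := by
  unfold slowAvg
  rw [← lintegral_const_mul' _ _ ENNReal.ofReal_ne_top]
  refine lintegral_mono fun z => ?_
  rw [← mul_assoc (ENNReal.ofReal _) (ENNReal.ofReal _), ← ENNReal.ofReal_mul (by positivity),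
    ← mul_pow]
  gcongr
  have h2 : (0 : ℝ) < 2 ^ m := by positivity
  have hz : 0 < 1 + δ * (2 ^ m * dist x z) := by positivity
  have hy : 0 < 1 + δ * (2 ^ m * dist y z) := by positivity
  rw [inv_eq_one_div, ← div_eq_mul_inv, div_le_div_iff₀ hz hy, one_mul]
  have htri : dist y z ≤ dist x y + dist x z := by
    rw [dist_comm x y]; exact dist_triangle y x z
  have h3 : δ * (2 ^ m * dist y z) ≤ δ * (2 ^ m * (dist x y + dist x z)) := by gcongr
  have h4 : 0 ≤ (δ * (2 ^ m * dist x y)) * (δ * (2 ^ m * dist x z)) := by positivity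
  nlinarith

lemma two_zpow_mul_le_one {m n : ℤ} (hmn : m ≤ n) {d : ℝ} (hd : d ≤ 2 ^ (-n)) :
    (2 : ℝ) ^ m * d ≤ 1 := by
  calc (2 : ℝ) ^ m * d ≤ 2 ^ n * 2 ^ (-n) := by
        have : (2 : ℝ) ^ m ≤ 2 ^ n := zpow_le_zpow_right₀ (by norm_num) hmn
        have h0 : (0 : ℝ) < 2 ^ m := by positivity
        have h1 : (0 : ℝ) < 2 ^ (-n) := by positivity
        nlinarith
    _ = 1 := by rw [← zpow_add₀ (by norm_num)]; simp

omit [BorelSpace X] in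
lemma slowAvg_le_of_dist_le (μ : Measure X) {δ : ℝ} (hδ : 0 ≤ δ) (L : ℕ) (F : X → ℝ≥0∞)
    {m n : ℤ} (hmn : m ≤ n) {x y : X} (hxy : dist x y ≤ 2 ^ (-n)) :
    slowAvg μ δ L F m x ≤ ENNReal.ofReal ((1 + δ) ^ L) * slowAvg μ δ L F m y := by
  refine (slowAvg_le_mul μ hδ L F m x y).trans ?_
  gcongr
  exact mul_le_of_le_one_right hδ (two_zpow_mul_le_one hmn hxy)

omit [BorelSpace X] in
lemma lowerSemicontinuous_slowAvg (μ : Measure X) {δ : ℝ} (hδ : 0 ≤ δ) (L : ℕ)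
    (F : X → ℝ≥0∞) (m : ℤ) : LowerSemicontinuous (slowAvg μ δ L F m) := by
  intro x t ht
  have hcont : ContinuousAt
      (fun y => t * ENNReal.ofReal ((1 + δ * (2 ^ m * dist x y)) ^ L)) x := by
    refine ENNReal.Tendsto.const_mul ?_ (Or.inr (ne_top_of_lt ht))
    refine (ENNReal.continuous_ofReal.comp ?_).continuousAt
    fun_prop
  have hx : t * ENNReal.ofReal ((1 + δ * (2 ^ m * dist x x)) ^ L) < slowAvg μ δ L F m x := by
    simpa using ht
  filter_upwards [hcont.eventually_lt_const hx] with y hy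
  have h := hy.trans_le (slowAvg_le_mul μ hδ L F m x y)
  rw [mul_comm] at h
  exact lt_of_mul_lt_mul_left' h

lemma measurable_slowAvg (μ : Measure X) {δ : ℝ} (hδ : 0 ≤ δ) (L : ℕ)
    (F : X → ℝ≥0∞) (m : ℤ) : Measurable (slowAvg μ δ L F m) :=
  (lowerSemicontinuous_slowAvg μ hδ L F m).measurable

omit [BorelSpace X] in
lemma ballAvg_le_slowAvg (μ : Measure X) {δ : ℝ} (hδ : 0 ≤ δ) (L : ℕ) {f F : X → ℝ≥0∞}
    (hfF : f ≤ F) (n : ℤ) (x : X) :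
    ballAvg μ n f x ≤ ENNReal.ofReal ((1 + δ) ^ L) * slowAvg μ δ L F n x := by
  unfold ballAvg slowAvg
  rw [← lintegral_const_mul' _ _ ENNReal.ofReal_ne_top]
  refine lintegral_mono fun y => ?_
  by_cases hx : x ∈ ball y ((2 : ℝ) ^ (-n))
  · rw [indicator_of_mem hx, one_mul, ← mul_assoc, ← ENNReal.ofReal_mul (by positivity),
      ← mul_pow]
    have h1 : 1 ≤ ENNReal.ofReal (((1 + δ) * (1 + δ * (2 ^ n * dist x y))⁻¹) ^ L) := by
      rw [ENNReal.one_le_ofReal]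
      refine one_le_pow₀ ?_
      have hp : 0 < 1 + δ * (2 ^ n * dist x y) := by positivity
      rw [← div_eq_mul_inv, one_le_div hp]
      gcongr
      exact mul_le_of_le_one_right hδ (two_zpow_mul_le_one le_rfl (mem_ball.1 hx).le)
    calc f y / _ ≤ F y / μ (ball y ((2 : ℝ) ^ (-n))) := by gcongr; exact hfF y
      _ ≤ _ := le_mul_of_one_le_left' h1
  · rw [indicator_of_notMem hx]; simp

omit [BorelSpace X] in
lemma measure_ball_two_pow_mul_le {μ : Measure X} {c : ℝ≥0∞} (hdbl : IsDoubling μ c) (x : X)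
    {r : ℝ} (hr : 0 < r) (k : ℕ) : μ (ball x (2 ^ k * r)) ≤ c ^ k * μ (ball x r) := by
  induction k with
  | zero => simp
  | succ k ih =>
    calc μ (ball x (2 ^ (k + 1) * r)) = μ (ball x (2 * (2 ^ k * r))) := by ring_nf
      _ ≤ c * μ (ball x (2 ^ k * r)) := hdbl x _ (by positivity)
      _ ≤ c * (c ^ k * μ (ball x r)) := by gcongr
      _ = c ^ (k + 1) * μ (ball x r) := by ring

lemma setLIntegral_ball_le_ballAvg {μ : Measure X} {c : ℝ≥0∞} (hdbl : IsDoubling μ c)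
    (hpos : ∀ (x : X) (r : ℝ), 0 < r → 0 < μ (ball x r))
    (hfin : ∀ (x : X) (r : ℝ), μ (ball x r) ≠ ∞) (hc : c ≠ ∞)
    (n : ℤ) (f : X → ℝ≥0∞) (x : X) :
    ∫⁻ y in ball x ((2 : ℝ) ^ (-n)), f y ∂μ ≤
      c * μ (ball x ((2 : ℝ) ^ (-n))) * ballAvg μ n f x := by
  unfold ballAvg
  rw [← lintegral_const_mul' _ _ (ENNReal.mul_ne_top hc (hfin _ _)),
    ← lintegral_indicator measurableSet_ball]
  refine lintegral_mono fun y => ?_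
  by_cases hy : y ∈ ball x ((2 : ℝ) ^ (-n))
  · have hx : x ∈ ball y ((2 : ℝ) ^ (-n)) := mem_ball_comm.1 hy
    have h0 : (0 : ℝ) < 2 ^ (-n) := by positivity
    rw [indicator_of_mem hy, indicator_of_mem hx, one_mul, mul_div_assoc',
      ENNReal.le_div_iff_mul_le (Or.inl (hpos _ _ h0).ne') (Or.inl (hfin _ _)), mul_comm]
    gcongr
    calc μ (ball y ((2 : ℝ) ^ (-n))) ≤ μ (ball x (2 * (2 : ℝ) ^ (-n))) := by
          refine measure_mono (ball_subset_ball' ?_)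
          have := mem_ball.1 hy
          linarith
      _ ≤ _ := hdbl x _ h0
  · rw [indicator_of_notMem hy]; exact zero_le

lemma inv_one_add_pow_le {δ ρ : ℝ} (hδ : 0 < δ) (hδ1 : δ ≤ 1) (hρ : 0 ≤ ρ) (L : ℕ) :
    ∃ k : ℕ, ρ < 2 ^ k ∧ ((1 + δ * ρ)⁻¹) ^ L ≤ (2 / δ) ^ L * (((1 / 2 : ℝ) ^ L) ^ k) := by
  have hex : ∃ k : ℕ, ρ < 2 ^ k := pow_unbounded_of_one_lt ρ (by norm_num)
  classical
  refine ⟨Nat.find hex, Nat.find_spec hex, ?_⟩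
  rw [← pow_mul, mul_comm L, pow_mul, ← mul_pow]
  gcongr
  have hp : 0 < 1 + δ * ρ := by positivity
  rcases hk : Nat.find hex with _ | k
  · rw [pow_zero, mul_one]
    calc (1 + δ * ρ)⁻¹ ≤ 1 := inv_le_one_of_one_le₀ (by nlinarith)
      _ ≤ 2 / δ := by rw [le_div_iff₀ hδ]; linarith
  · have hmin : (2 : ℝ) ^ k ≤ ρ := by
      have := Nat.find_min hex (m := k) (by omega)
      exact not_lt.1 this
    have h2 : (0 : ℝ) < 2 ^ k := by positivity
    calc (1 + δ * ρ)⁻¹ ≤ (δ * 2 ^ k)⁻¹ := by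
          apply inv_anti₀ (by positivity)
          nlinarith
      _ = 2 / δ * (1 / 2) ^ (k + 1) := by
          rw [pow_succ, one_div_pow]; field_simp

/-- The constant bounding `slowAvg` by averages over balls. -/
def slowConst (c : ℝ≥0∞) (δ : ℝ) (L : ℕ) : ℝ≥0∞ :=
  ENNReal.ofReal ((2 / δ) ^ L) * c * (1 - ENNReal.ofReal ((1 / 2 : ℝ) ^ L) * c)⁻¹

lemma slowAvg_le_of_average_le {μ : Measure X} {c : ℝ≥0∞} (hdbl : IsDoubling μ c)
    (hpos : ∀ (x : X) (r : ℝ), 0 < r → 0 < μ (ball x r))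
    (hfin : ∀ (x : X) (r : ℝ), μ (ball x r) ≠ ∞) (hc : c ≠ ∞)
    {δ : ℝ} (hδ : 0 < δ) (hδ1 : δ ≤ 1) (L : ℕ) {F : X → ℝ≥0∞} (hF : Measurable F)
    {s : ℝ≥0∞} {x : X} (hs : ∀ r : ℝ, 0 < r → ∫⁻ z in ball x r, F z ∂μ ≤ s * μ (ball x r))
    (m : ℤ) : slowAvg μ δ L F m x ≤ slowConst c δ L * s := by
  set r : ℝ := 2 ^ (-m) with hr
  have hr0 : 0 < r := by positivity
  set a : ℕ → ℝ≥0∞ := fun k =>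
    ENNReal.ofReal ((2 / δ) ^ L) * ENNReal.ofReal ((1 / 2 : ℝ) ^ L) ^ k * c ^ (k + 1) with ha
  have ha_top : ∀ k, a k ≠ ∞ := fun k => by
    simp only [ha]
    exact ENNReal.mul_ne_top (ENNReal.mul_ne_top ENNReal.ofReal_ne_top
      (ENNReal.pow_ne_top ENNReal.ofReal_ne_top)) (ENNReal.pow_ne_top hc)
  have hbpos : ∀ k : ℕ, μ (ball x (2 ^ k * r)) ≠ 0 := fun k => (hpos _ _ (by positivity)).ne'
  have hpt : ∀ z, ENNReal.ofReal (((1 + δ * (2 ^ m * dist x z))⁻¹) ^ L) * (F z / μ (ball z r)) ≤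
      ∑' k : ℕ, a k / μ (ball x (2 ^ k * r)) * (ball x (2 ^ k * r)).indicator F z := by
    intro z
    obtain ⟨k, hk1, hk2⟩ := inv_one_add_pow_le (ρ := 2 ^ m * dist x z) hδ hδ1 (by positivity) L
    refine le_trans ?_ (ENNReal.le_tsum k)
    have hdist : dist x z < 2 ^ k * r := by
      have h2 : (2 : ℝ) ^ m * r = 1 := by rw [hr, ← zpow_add₀ (by norm_num)]; simp
      calc dist x z = (2 ^ m * dist x z) * r := by rw [mul_right_comm, h2, one_mul]
        _ < 2 ^ k * r := by gcongr
    have hz : z ∈ ball x (2 ^ k * r) := by rwa [mem_ball, dist_comm]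
    rw [indicator_of_mem hz]
    have hw : ENNReal.ofReal (((1 + δ * (2 ^ m * dist x z))⁻¹) ^ L) ≤
        ENNReal.ofReal ((2 / δ) ^ L) * ENNReal.ofReal ((1 / 2 : ℝ) ^ L) ^ k := by
      rw [← ENNReal.ofReal_pow (by positivity), ← ENNReal.ofReal_mul (by positivity)]
      exact ENNReal.ofReal_le_ofReal hk2
    have hball : μ (ball x (2 ^ k * r)) ≤ c ^ (k + 1) * μ (ball z r) := by
      refine le_trans (measure_mono (ball_subset_ball' ?_))
        (measure_ball_two_pow_mul_le hdbl z hr0 (k + 1))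
      rw [pow_succ]; linarith
    have hinv : (μ (ball z r))⁻¹ ≤ c ^ (k + 1) / μ (ball x (2 ^ k * r)) := by
      rw [ENNReal.le_div_iff_mul_le (Or.inl (hbpos k)) (Or.inl (hfin _ _)), mul_comm,
        ← div_eq_mul_inv,
        ENNReal.div_le_iff_le_mul (Or.inl (hpos z r hr0).ne') (Or.inl (hfin _ _))]
      exact hball
    calc _ ≤ (ENNReal.ofReal ((2 / δ) ^ L) * ENNReal.ofReal ((1 / 2 : ℝ) ^ L) ^ k) *
          (F z * (c ^ (k + 1) / μ (ball x (2 ^ k * r)))) := by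
          rw [div_eq_mul_inv (F z)]; gcongr
      _ = _ := by simp only [ha, div_eq_mul_inv]; ring
  calc slowAvg μ δ L F m x
      ≤ ∫⁻ z, ∑' k : ℕ, a k / μ (ball x (2 ^ k * r)) *
          (ball x (2 ^ k * r)).indicator F z ∂μ := lintegral_mono hpt
    _ = ∑' k : ℕ, a k / μ (ball x (2 ^ k * r)) * ∫⁻ z in ball x (2 ^ k * r), F z ∂μ := by
        rw [lintegral_tsum fun k => ((hF.indicator measurableSet_ball).const_mul _).aemeasurable]
        refine tsum_congr fun k => ?_
        rw [lintegral_const_mul _ (hF.indicator measurableSet_ball),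
          lintegral_indicator measurableSet_ball]
    _ ≤ ∑' k : ℕ, a k * s := by
        refine ENNReal.tsum_le_tsum fun k => ?_
        calc _ ≤ a k / μ (ball x (2 ^ k * r)) * (s * μ (ball x (2 ^ k * r))) := by
              gcongr; exact hs _ (by positivity)
          _ = a k * s := by
              rw [mul_comm s, ← mul_assoc, ENNReal.div_mul_cancel (hbpos k) (hfin _ _)]
    _ = slowConst c δ L * s := by
        rw [ENNReal.tsum_mul_right, slowConst, ← ENNReal.tsum_geometric, ← ENNReal.tsum_mul_left]
        congr 1
        refine tsum_congr fun k => ?_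
        simp only [ha, mul_pow]; ring

lemma slowConst_ne_top {c : ℝ≥0∞} (hc : c ≠ ∞) (δ : ℝ) {L : ℕ} (hL : c < 2 ^ L) :
    slowConst c δ L ≠ ∞ := by
  refine ENNReal.mul_ne_top (ENNReal.mul_ne_top ENNReal.ofReal_ne_top hc) ?_
  rw [ENNReal.inv_ne_top, ← pos_iff_ne_zero, tsub_pos_iff_lt,
    ENNReal.ofReal_pow (by norm_num), one_div, ENNReal.ofReal_inv_of_pos (by norm_num),
    ENNReal.ofReal_ofNat, ← ENNReal.inv_pow, mul_comm, ← div_eq_mul_inv,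
    ENNReal.div_lt_iff (Or.inl (by simp)) (Or.inl (by simp)), one_mul]
  exact hL

lemma slowConst_ne_zero {c : ℝ≥0∞} (hc0 : c ≠ 0) {δ : ℝ} (hδ : 0 < δ) (L : ℕ) :
    slowConst c δ L ≠ 0 := by
  refine mul_ne_zero (mul_ne_zero ?_ hc0) ?_
  · exact (ENNReal.ofReal_pos.2 (by positivity)).ne'
  · exact ENNReal.inv_ne_zero.2 (ne_top_of_le_ne_top ENNReal.one_ne_top tsub_le_self)

/-! ### The maximal inequality -/

lemma measure_exists_lt_setLIntegral_le {μ : Measure X} {c : ℝ≥0∞} (hdbl : IsDoubling μ c)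
    (hc0 : c ≠ 0) {f : X → ℝ≥0∞} {s : ℝ≥0∞} (hs0 : s ≠ 0) (hs : s ≠ ∞) :
    μ {x | ∃ r : ℝ, 0 < r ∧ s * μ (ball x r) < ∫⁻ y in ball x r, f y ∂μ} ≤
      c ^ 3 * s⁻¹ * ∫⁻ y, f y ∂μ := by
  by_cases hint : ∫⁻ y, f y ∂μ = ∞
  · rw [hint, ENNReal.mul_top (mul_ne_zero (pow_ne_zero _ hc0) (ENNReal.inv_ne_zero.2 hs))]
    exact le_top
  set S : ℕ → Set X := fun R =>
    {x | ∃ r : ℝ, (0 < r ∧ r ≤ R) ∧ s * μ (ball x r) < ∫⁻ y in ball x r, f y ∂μ} with hS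
  have hunion : {x | ∃ r : ℝ, 0 < r ∧ s * μ (ball x r) < ∫⁻ y in ball x r, f y ∂μ} =
      ⋃ R, S R := by
    ext x
    simp only [hS, mem_ofPred_eq, mem_iUnion]
    constructor
    · rintro ⟨r, hr, h⟩
      obtain ⟨R, hR⟩ := exists_nat_ge r
      exact ⟨R, r, ⟨hr, hR⟩, h⟩
    · rintro ⟨R, r, ⟨hr, -⟩, h⟩
      exact ⟨r, hr, h⟩
  have hmono : Monotone S := by
    rintro R R' hR x ⟨r, ⟨hr, hrR⟩, h⟩
    exact ⟨r, ⟨hr, hrR.trans (by exact_mod_cast hR)⟩, h⟩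
  rw [hunion, hmono.directed_le.measure_iUnion]
  refine iSup_le fun R => ?_
  choose! r hr hlt using fun x (hx : x ∈ S R) => hx
  obtain ⟨u, huS, hdisj, hcov⟩ := Vitali.exists_disjoint_subfamily_covering_enlargement_closedBall
    (S R) id r R (fun x hx => (hr x hx).2) 5 (by norm_num)
  have hdisj' : u.PairwiseDisjoint fun a => ball a (r a) := fun a ha b hb hab =>
    (hdisj ha hb hab).mono ball_subset_closedBall ball_subset_closedBall
  have hcount : u.Countable := by
    have : IsFiniteMeasure (μ.withDensity f) := isFiniteMeasure_withDensity hint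
    have h := Measure.countable_meas_pos_of_disjoint_iUnion (μ := μ.withDensity f)
      (As := fun a : u => ball (a : X) (r a)) (fun _ => measurableSet_ball)
      (fun a b hab => hdisj' a.2 b.2 fun h => hab (Subtype.ext h))
    have huniv : {a : u | 0 < μ.withDensity f (ball (a : X) (r a))} = univ := by
      refine eq_univ_of_forall fun a => ?_
      rw [mem_ofPred_eq, withDensity_apply _ measurableSet_ball]
      exact (hlt a (huS a.2)).pos
    rw [huniv] at h
    exact countable_coe_iff.1 (countable_univ_iff.1 h)
  have hball : ∀ a ∈ u, μ (closedBall a (5 * r a)) ≤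
      c ^ 3 * s⁻¹ * ∫⁻ y in ball a (r a), f y ∂μ := by
    intro a ha
    have hra := (hr a (huS ha)).1
    calc μ (closedBall a (5 * r a)) ≤ μ (ball a (2 ^ 3 * r a)) :=
          measure_mono (closedBall_subset_ball (by linarith))
      _ ≤ c ^ 3 * μ (ball a (r a)) := measure_ball_two_pow_mul_le hdbl a hra 3
      _ = c ^ 3 * s⁻¹ * (s * μ (ball a (r a))) := by
          rw [mul_assoc, ← mul_assoc s⁻¹, ENNReal.inv_mul_cancel hs0 hs, one_mul]
      _ ≤ _ := by gcongr; exact (hlt a (huS ha)).le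
  calc μ (S R) ≤ μ (⋃ a ∈ u, closedBall a (5 * r a)) := by
        refine measure_mono fun x hx => ?_
        obtain ⟨b, hb, hsub⟩ := hcov x hx
        exact mem_biUnion hb (hsub (mem_closedBall_self (hr x hx).1.le))
    _ ≤ ∑' a : u, μ (closedBall (a : X) (5 * r a)) := measure_biUnion_le μ hcount _
    _ ≤ ∑' a : u, c ^ 3 * s⁻¹ * ∫⁻ y in ball (a : X) (r a), f y ∂μ :=
        ENNReal.tsum_le_tsum fun a => hball a a.2
    _ = c ^ 3 * s⁻¹ * ∫⁻ y in ⋃ a ∈ u, ball a (r a), f y ∂μ := by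
        rw [ENNReal.tsum_mul_left, lintegral_biUnion hcount (fun _ _ => measurableSet_ball) hdisj']
    _ ≤ _ := by gcongr; exact Measure.restrict_le_self

lemma measure_exists_lt_setLIntegral_le_truncated {μ : Measure X} {c : ℝ≥0∞}
    (hdbl : IsDoubling μ c) (hc0 : c ≠ 0) {F : X → ℝ≥0∞} (hF : Measurable F)
    {s : ℝ≥0∞} (hs0 : s ≠ 0) (hs : s ≠ ∞) :
    μ {x | ∃ r : ℝ, 0 < r ∧ s * μ (ball x r) < ∫⁻ y in ball x r, F y ∂μ} ≤
      2 * c ^ 3 * (s⁻¹ * ∫⁻ y, {y | s < 2 * F y}.indicator F y ∂μ) := by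
  have hmeas : MeasurableSet {y | s < 2 * F y} := measurableSet_lt measurable_const (hF.const_mul 2)
  have hhalf : s / 2 ≠ ∞ := ENNReal.div_ne_top hs (by norm_num)
  have h := measure_exists_lt_setLIntegral_le hdbl hc0 (f := {y | s < 2 * F y}.indicator F) (s := s / 2)
    (ENNReal.div_ne_zero.2 ⟨hs0, by norm_num⟩) hhalf
  refine (measure_mono ?_).trans (h.trans_eq ?_)
  · rintro x ⟨r, hr, hlt⟩
    refine ⟨r, hr, ?_⟩
    have hle : ∫⁻ y in ball x r, F y ∂μ ≤
        s / 2 * μ (ball x r) + ∫⁻ y in ball x r, {y | s < 2 * F y}.indicator F y ∂μ := by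
      rw [← setLIntegral_const, ← lintegral_add_left measurable_const]
      refine lintegral_mono fun y => ?_
      by_cases hy : y ∈ {y | s < 2 * F y}
      · rw [indicator_of_mem hy]; exact le_add_self
      · rw [indicator_of_notMem hy, add_zero,
          ENNReal.le_div_iff_mul_le (Or.inl (by norm_num)) (Or.inl (by norm_num)), mul_comm]
        exact not_lt.1 hy
    have hlt' := hlt.trans_le hle
    rw [← ENNReal.add_halves s, add_mul] at hlt'
    simp only [ENNReal.add_halves] at hlt'
    exact lt_of_add_lt_add_left hlt'
  · rw [div_eq_mul_inv, ENNReal.mul_inv (Or.inl hs0) (Or.inl hs), inv_inv]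
    ring

lemma rpow_le_tsum_dyadic {p : ℝ} (hp : 0 < p) {K : ℝ≥0∞} (hK0 : K ≠ 0) (hK : K ≠ ∞)
    (a : ℝ≥0∞) :
    a ^ p ≤ ∑' j : ℤ, (Ioi (K * 2 ^ j)).indicator (fun _ => (K * 2 ^ (j + 1)) ^ p) a := by
  rw [← ENNReal.le_rpow_inv_iff hp]
  refine le_of_forall_lt_imp_le_of_dense fun b hb => ?_
  rw [ENNReal.le_rpow_inv_iff hp]
  rcases eq_or_ne b 0 with rfl | hb0
  · simp [hp]
  obtain ⟨j, hj1, hj2⟩ := ENNReal.exists_mem_Ioc_zpow (x := b / K) (y := 2)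
    (ENNReal.div_ne_zero.2 ⟨hb0, hK⟩) (ENNReal.div_ne_top (ne_top_of_lt hb) hK0)
    (by norm_num) (by norm_num)
  refine le_trans ?_ (ENNReal.le_tsum j)
  rw [ENNReal.lt_div_iff_mul_lt (Or.inl hK0) (Or.inl hK), mul_comm] at hj1
  rw [ENNReal.div_le_iff hK0 hK, mul_comm] at hj2
  rw [indicator_of_mem (mem_Ioi.2 (hj1.trans hb))]
  gcongr

lemma tsum_dyadic_le {t : ℝ} (ht : 0 < t) (b : ℝ≥0∞) :
    ∑' j : ℤ, (Ioi ((2 : ℝ≥0∞) ^ j)).indicator (fun _ => ((2 : ℝ≥0∞) ^ j) ^ t) b ≤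
      (1 - 2 ^ (-t))⁻¹ * b ^ t := by
  rcases eq_or_ne b 0 with rfl | hb0
  · simp
  rcases eq_or_ne b ∞ with rfl | hb
  · rw [ENNReal.top_rpow_of_pos ht, ENNReal.mul_top]
    · exact le_top
    · exact ENNReal.inv_ne_zero.2 (ne_top_of_le_ne_top ENNReal.one_ne_top tsub_le_self)
  obtain ⟨J, hJ1, hJ2⟩ := ENNReal.exists_mem_Ioc_zpow hb0 hb (y := 2) (by norm_num) (by norm_num)
  have hinj : Function.Injective (fun i : ℕ => J - (i : ℤ)) := fun i j h => by
    simpa using h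
  rw [← hinj.tsum_eq, ← ENNReal.tsum_geometric, ← ENNReal.tsum_mul_right]
  · refine ENNReal.tsum_le_tsum fun i => (indicator_le_self _ _ _).trans ?_
    have h2 : ((2 : ℝ≥0∞) ^ (J - (i : ℤ))) ^ t = (2 ^ (-t)) ^ i * ((2 : ℝ≥0∞) ^ J) ^ t := by
      rw [← ENNReal.rpow_intCast, ← ENNReal.rpow_intCast, ← ENNReal.rpow_natCast,
        ← ENNReal.rpow_mul, ← ENNReal.rpow_mul, ← ENNReal.rpow_mul,
        ← ENNReal.rpow_add _ _ (by norm_num) (by norm_num)]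
      push_cast
      ring_nf
    rw [h2]
    gcongr
  · intro j hj
    have hjb : (2 : ℝ≥0∞) ^ j < b := by
      by_contra h
      exact hj (indicator_of_notMem (notMem_Ioi.2 (not_lt.1 h)) _)
    have hlt : j < J + 1 := by
      by_contra! h
      exact (hjb.trans_le hJ2).not_ge (ENNReal.zpow_le_of_le (by norm_num) h)
    exact ⟨(J - j).toNat, by simp only; omega⟩

omit [MetricSpace X] [BorelSpace X] in
/-- Marcinkiewicz interpolation between a truncated weak type `(1, 1)` bound and `L^∞`. -/
lemma lintegral_rpow_le_of_weak {μ : Measure X} {p : ℝ} (hp : 1 < p) {K A : ℝ≥0∞} (hK0 : K ≠ 0)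
    (hK : K ≠ ∞) {T F : X → ℝ≥0∞} (hT : Measurable T) (hF : Measurable F)
    (hweak : ∀ s : ℝ≥0∞, s ≠ 0 → s ≠ ∞ →
      μ {x | K * s < T x} ≤ A * (s⁻¹ * ∫⁻ y, {y | s < 2 * F y}.indicator F y ∂μ)) :
    ∫⁻ x, T x ^ p ∂μ ≤
      (K * 2) ^ p * A * (1 - 2 ^ (-(p - 1)))⁻¹ * 2 ^ (p - 1) * ∫⁻ x, F x ^ p ∂μ := by
  have h2 : ∀ j : ℤ, (2 : ℝ≥0∞) ^ j ≠ 0 := fun j =>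
    (ENNReal.zpow_pos (by norm_num) (by norm_num) j).ne'
  have h2' : ∀ j : ℤ, (2 : ℝ≥0∞) ^ j ≠ ∞ := fun j =>
    ENNReal.zpow_ne_top (by norm_num) (by norm_num) j
  have hpow : ∀ j : ℤ, (K * 2 ^ (j + 1)) ^ p * ((2 : ℝ≥0∞) ^ j)⁻¹ =
      (K * 2) ^ p * ((2 : ℝ≥0∞) ^ j) ^ (p - 1) := by
    intro j
    rw [ENNReal.zpow_add (by norm_num) (by norm_num), zpow_one, mul_comm ((2 : ℝ≥0∞) ^ j),
      ← mul_assoc, ENNReal.mul_rpow_of_nonneg _ _ (by linarith), mul_assoc,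
      ← ENNReal.rpow_neg_one ((2 : ℝ≥0∞) ^ j), ← ENNReal.rpow_add _ _ (h2 j) (h2' j),
      sub_eq_add_neg]
  calc ∫⁻ x, T x ^ p ∂μ
      ≤ ∫⁻ x, ∑' j : ℤ, (Ioi (K * 2 ^ j)).indicator
          (fun _ => (K * 2 ^ (j + 1)) ^ p) (T x) ∂μ :=
        lintegral_mono fun x => rpow_le_tsum_dyadic (by linarith) hK0 hK (T x)
    _ = ∑' j : ℤ, (K * 2 ^ (j + 1)) ^ p * μ {x | K * 2 ^ j < T x} := by
        refine (lintegral_tsum fun j => Measurable.aemeasurable ?_).trans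
          (tsum_congr fun j => ?_)
        · exact (measurable_const.indicator measurableSet_Ioi).comp hT
        · exact lintegral_indicator_const (measurableSet_lt measurable_const hT) _
    _ ≤ ∑' j : ℤ, (K * 2 ^ (j + 1)) ^ p *
          (A * (((2 : ℝ≥0∞) ^ j)⁻¹ * ∫⁻ y, {y | 2 ^ j < 2 * F y}.indicator F y ∂μ)) := by
        gcongr with j
        exact hweak _ (h2 j) (h2' j)
    _ = ∑' j : ℤ, ∫⁻ y, (K * 2) ^ p * A * (F y *
          (Ioi ((2 : ℝ≥0∞) ^ j)).indicator (fun _ => ((2 : ℝ≥0∞) ^ j) ^ (p - 1)) (2 * F y)) ∂μ := by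
        refine tsum_congr fun j => ?_
        have hm : MeasurableSet {y | (2 : ℝ≥0∞) ^ j < 2 * F y} :=
          measurableSet_lt measurable_const (hF.const_mul 2)
        calc _ = (K * 2) ^ p * A * ((2 : ℝ≥0∞) ^ j) ^ (p - 1) *
              ∫⁻ y, {y | 2 ^ j < 2 * F y}.indicator F y ∂μ := by
              rw [mul_left_comm A, ← mul_assoc, hpow]; ring
          _ = _ := by
              rw [← lintegral_const_mul _ (hF.indicator hm)]
              refine lintegral_congr fun y => ?_
              by_cases hy : (2 : ℝ≥0∞) ^ j < 2 * F y
              · rw [indicator_of_mem (show y ∈ {y | (2 : ℝ≥0∞) ^ j < 2 * F y} from hy),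
                  indicator_of_mem (mem_Ioi.2 hy)]
                ring
              · rw [indicator_of_notMem (show y ∉ {y | (2 : ℝ≥0∞) ^ j < 2 * F y} from hy),
                  indicator_of_notMem (notMem_Ioi.2 (not_lt.1 hy))]
                ring
    _ = ∫⁻ y, ∑' j : ℤ, (K * 2) ^ p * A * (F y *
          (Ioi ((2 : ℝ≥0∞) ^ j)).indicator (fun _ => ((2 : ℝ≥0∞) ^ j) ^ (p - 1)) (2 * F y)) ∂μ := by
        refine (lintegral_tsum fun j => Measurable.aemeasurable ?_).symm
        exact (hF.mul ((measurable_const.indicator measurableSet_Ioi).comp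
          (hF.const_mul 2))).const_mul _
    _ ≤ ∫⁻ y, (K * 2) ^ p * A * (1 - 2 ^ (-(p - 1)))⁻¹ * 2 ^ (p - 1) * F y ^ p ∂μ := by
        refine lintegral_mono fun y => ?_
        rw [ENNReal.tsum_mul_left, ENNReal.tsum_mul_left]
        calc _ ≤ (K * 2) ^ p * A * (F y * ((1 - 2 ^ (-(p - 1)))⁻¹ * (2 * F y) ^ (p - 1))) := by
              gcongr
              exact tsum_dyadic_le (by linarith) _
          _ = (K * 2) ^ p * A * (1 - 2 ^ (-(p - 1)))⁻¹ * 2 ^ (p - 1) *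
                (F y ^ (1 : ℝ) * F y ^ (p - 1)) := by
              rw [ENNReal.mul_rpow_of_nonneg 2 (F y) (by linarith), ENNReal.rpow_one]; ring
          _ = _ := by
              rw [← ENNReal.rpow_add_of_nonneg _ _ (by norm_num) (by linarith), add_sub_cancel]
    _ = _ := lintegral_const_mul _ (hF.pow_const p)

lemma lintegral_iSup_slowAvg_rpow_le {μ : Measure X} {c : ℝ≥0∞} (hdbl : IsDoubling μ c)
    (hpos : ∀ (x : X) (r : ℝ), 0 < r → 0 < μ (ball x r))
    (hfin : ∀ (x : X) (r : ℝ), μ (ball x r) ≠ ∞) (hc0 : c ≠ 0) (hc : c ≠ ∞)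
    {p : ℝ} (hp : 1 < p) {δ : ℝ} (hδ : 0 < δ) (hδ1 : δ ≤ 1) {L : ℕ} (hL : c < 2 ^ L)
    {F : X → ℝ≥0∞} (hF : Measurable F) :
    ∫⁻ x, (⨆ m, slowAvg μ δ L F m x) ^ p ∂μ ≤
      (slowConst c δ L * 2) ^ p * (2 * c ^ 3) * (1 - 2 ^ (-(p - 1)))⁻¹ * 2 ^ (p - 1) *
        ∫⁻ x, F x ^ p ∂μ := by
  refine lintegral_rpow_le_of_weak hp (slowConst_ne_zero hc0 hδ L) (slowConst_ne_top hc δ hL)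
    (Measurable.iSup fun m => measurable_slowAvg μ hδ.le L F m) hF fun s hs0 hs => ?_
  refine (measure_mono ?_).trans
    (measure_exists_lt_setLIntegral_le_truncated hdbl hc0 hF hs0 hs)
  intro x hx
  obtain ⟨m, hm⟩ := lt_iSup_iff.1 (mem_ofPred_eq ▸ hx)
  by_contra hcon
  simp only [mem_ofPred_eq, not_exists, not_and, not_lt] at hcon
  exact hm.not_ge (slowAvg_le_of_average_le hdbl hpos hfin hc hδ hδ1 L hF hcon m)

/-! ### Running suprema over scales and their increments -/

/-- The supremum of `slowAvg` over the valid scales between `N` and `n`. -/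
def runSup (μ : Measure X) (δ : ℝ) (L : ℕ) (F : X → ℝ≥0∞) (N n : ℤ) (x : X) : ℝ≥0∞ :=
  ⨆ (m : ℤ) (_ : N ≤ m ∧ m ≤ n ∧ validIdx X m), slowAvg μ δ L F m x

/-- The increment of `runSup` at scale `n`. -/
def runInc (μ : Measure X) (δ : ℝ) (L : ℕ) (F : X → ℝ≥0∞) (N n : ℤ) (x : X) : ℝ≥0∞ :=
  runSup μ δ L F N n x - runSup μ δ L F N (n - 1) x

omit [BorelSpace X] in
lemma slowAvg_le_runSup (μ : Measure X) (δ : ℝ) (L : ℕ) (F : X → ℝ≥0∞) {N n m : ℤ}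
    (h1 : N ≤ m) (h2 : m ≤ n) (hv : validIdx X m) (x : X) :
    slowAvg μ δ L F m x ≤ runSup μ δ L F N n x :=
  le_iSup₂_of_le m ⟨h1, h2, hv⟩ le_rfl

omit [BorelSpace X] in
lemma runSup_le_iSup (μ : Measure X) (δ : ℝ) (L : ℕ) (F : X → ℝ≥0∞) (N n : ℤ) (x : X) :
    runSup μ δ L F N n x ≤ ⨆ m, slowAvg μ δ L F m x :=
  iSup₂_le fun m _ => le_iSup (fun m => slowAvg μ δ L F m x) m

omit [BorelSpace X] in
lemma runSup_mono (μ : Measure X) (δ : ℝ) (L : ℕ) (F : X → ℝ≥0∞) (N : ℤ) {n n' : ℤ}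
    (h : n ≤ n') (x : X) : runSup μ δ L F N n x ≤ runSup μ δ L F N n' x :=
  iSup₂_le fun _ hm => slowAvg_le_runSup μ δ L F hm.1 (hm.2.1.trans h) hm.2.2 x

omit [BorelSpace X] in
lemma runSup_of_lt (μ : Measure X) (δ : ℝ) (L : ℕ) (F : X → ℝ≥0∞) {N n : ℤ} (h : n < N)
    (x : X) : runSup μ δ L F N n x = 0 :=
  le_zero_iff.1 (iSup₂_le fun _ hm => absurd (hm.1.trans hm.2.1) (not_le.2 h))

omit [BorelSpace X] in
lemma runInc_of_lt (μ : Measure X) (δ : ℝ) (L : ℕ) (F : X → ℝ≥0∞) {N n : ℤ} (h : n < N)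
    (x : X) : runInc μ δ L F N n x = 0 := by
  rw [runInc, runSup_of_lt μ δ L F h, zero_tsub]

omit [BorelSpace X] in
lemma runInc_of_not_validIdx (μ : Measure X) (δ : ℝ) (L : ℕ) (F : X → ℝ≥0∞) (N : ℤ) {n : ℤ}
    (h : ¬ validIdx X n) (x : X) : runInc μ δ L F N n x = 0 := by
  refine tsub_eq_zero_of_le (iSup₂_le fun m hm => ?_)
  have hne : m ≠ n := fun h' => h (h' ▸ hm.2.2)
  have := hm.2.1
  exact slowAvg_le_runSup μ δ L F hm.1 (by omega) hm.2.2 x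

omit [BorelSpace X] in
lemma runInc_add_runSup (μ : Measure X) (δ : ℝ) (L : ℕ) (F : X → ℝ≥0∞) (N n : ℤ) (x : X) :
    runInc μ δ L F N n x + runSup μ δ L F N (n - 1) x = runSup μ δ L F N n x :=
  tsub_add_cancel_of_le (runSup_mono μ δ L F N (by omega) x)

lemma measurable_runSup (μ : Measure X) {δ : ℝ} (hδ : 0 ≤ δ) (L : ℕ) (F : X → ℝ≥0∞)
    (N n : ℤ) : Measurable (runSup μ δ L F N n) :=
  Measurable.iSup fun m => Measurable.iSup_Prop _ (measurable_slowAvg μ hδ L F m)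

lemma measurable_runInc (μ : Measure X) {δ : ℝ} (hδ : 0 ≤ δ) (L : ℕ) (F : X → ℝ≥0∞)
    (N n : ℤ) : Measurable (runInc μ δ L F N n) :=
  (measurable_runSup μ hδ L F N n).sub (measurable_runSup μ hδ L F N (n - 1))

lemma injective_add_natCast (N : ℤ) : Function.Injective (fun k : ℕ => N + (k : ℤ)) :=
  fun i j h => by simpa using h

lemma mem_range_add_natCast {N n : ℤ} (h : N ≤ n) :
    n ∈ range (fun k : ℕ => N + (k : ℤ)) :=
  ⟨(n - N).toNat, by simp only; omega⟩

omit [BorelSpace X] in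
lemma tsum_runInc_le (μ : Measure X) (δ : ℝ) (L : ℕ) (F : X → ℝ≥0∞) (N : ℤ) (x : X) :
    ∑' n, runInc μ δ L F N n x ≤ ⨆ m, slowAvg μ δ L F m x := by
  rw [← (injective_add_natCast N).tsum_eq]
  · refine ENNReal.tsum_le_of_sum_range_le fun K => ?_
    have hsum : ∑ i ∈ Finset.range K, runInc μ δ L F N (N + (i : ℤ)) x =
        runSup μ δ L F N (N + K - 1) x := by
      induction K with
      | zero => rw [Finset.sum_range_zero, runSup_of_lt]; simp
      | succ K ih =>
        rw [Finset.sum_range_succ, ih, add_comm, runInc_add_runSup]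
        push_cast
        ring_nf
    rw [hsum]
    exact runSup_le_iSup ..
  · intro n hn
    refine mem_range_add_natCast (not_lt.1 fun h => hn ?_)
    exact runInc_of_lt μ δ L F h x

omit [BorelSpace X] in
lemma runSup_le_of_dist_le (μ : Measure X) {δ : ℝ} (hδ : 0 ≤ δ) (L : ℕ) (F : X → ℝ≥0∞)
    (N : ℤ) {m n : ℤ} (hmn : m ≤ n) {x y : X} (hxy : dist x y ≤ 2 ^ (-n)) :
    runSup μ δ L F N m x ≤ ENNReal.ofReal ((1 + δ) ^ L) * runSup μ δ L F N m y := by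
  refine iSup₂_le fun k hk => ?_
  refine (slowAvg_le_of_dist_le μ hδ L F (hk.2.1.trans hmn) hxy).trans ?_
  gcongr
  exact slowAvg_le_runSup μ δ L F hk.1 hk.2.1 hk.2.2 y

lemma runSup_le_ballAvg_add {μ : Measure X} {c : ℝ≥0∞} (hdbl : IsDoubling μ c)
    (hpos : ∀ (x : X) (r : ℝ), 0 < r → 0 < μ (ball x r))
    (hfin : ∀ (x : X) (r : ℝ), μ (ball x r) ≠ ∞) (hc : c ≠ ∞)
    {δ : ℝ} (hδ : 0 ≤ δ) (L : ℕ) (F : X → ℝ≥0∞) (N n : ℤ) (x : X) :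
    runSup μ δ L F N n x ≤
      ENNReal.ofReal ((1 + δ) ^ L) * c * ballAvg μ n (runInc μ δ L F N n) x +
        ENNReal.ofReal ((1 + δ) ^ L) ^ 2 * runSup μ δ L F N (n - 1) x := by
  set lam := ENNReal.ofReal ((1 + δ) ^ L)
  set B := ball x ((2 : ℝ) ^ (-n))
  have hB0 : μ B ≠ 0 := (hpos _ _ (by positivity)).ne'
  have hB : μ B ≠ ∞ := hfin _ _
  rw [← ENNReal.mul_le_mul_iff_left hB0 hB]
  calc runSup μ δ L F N n x * μ B = ∫⁻ _ in B, runSup μ δ L F N n x ∂μ :=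
        (setLIntegral_const _ _).symm
    _ ≤ ∫⁻ y in B, lam * runSup μ δ L F N n y ∂μ :=
        setLIntegral_mono' measurableSet_ball fun y hy =>
          runSup_le_of_dist_le μ hδ L F N le_rfl (mem_ball'.1 hy).le
    _ = lam * (∫⁻ y in B, runInc μ δ L F N n y ∂μ +
          ∫⁻ y in B, runSup μ δ L F N (n - 1) y ∂μ) := by
        rw [lintegral_const_mul' _ _ ENNReal.ofReal_ne_top,
          ← lintegral_add_left (measurable_runInc μ hδ L F N n)]
        simp only [runInc_add_runSup]
        rfl
    _ ≤ lam * (c * μ B * ballAvg μ n (runInc μ δ L F N n) x +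
          lam * runSup μ δ L F N (n - 1) x * μ B) := by
        gcongr
        · exact setLIntegral_ball_le_ballAvg hdbl hpos hfin hc n _ x
        · rw [← setLIntegral_const]
          exact setLIntegral_mono' measurableSet_ball fun y hy =>
            runSup_le_of_dist_le μ hδ L F N (by omega) (mem_ball.1 hy).le
    _ = _ := by ring

lemma one_sub_mul_tsum_le {A θ : ℝ≥0∞} (hθ : θ ≤ 1) {b h : ℕ → ℝ≥0∞} (h0 : b 0 ≤ A * h 0)
    (hsucc : ∀ k, b (k + 1) ≤ A * h (k + 1) + θ * b k) :
    (1 - θ) * ∑' k, b k ≤ A * ∑' k, h k := by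
  rw [← ENNReal.tsum_mul_left]
  refine ENNReal.tsum_le_of_sum_range_le fun K => ?_
  have key : ∀ K : ℕ, (1 - θ) * ∑ k ∈ Finset.range (K + 1), b k + θ * b K ≤
      A * ∑ k ∈ Finset.range (K + 1), h k := by
    intro K
    induction K with
    | zero => simpa [← add_mul, tsub_add_cancel_of_le hθ] using h0
    | succ K ih =>
      rw [Finset.sum_range_succ, mul_add, add_assoc, ← add_mul, tsub_add_cancel_of_le hθ, one_mul]
      calc _ ≤ (1 - θ) * ∑ k ∈ Finset.range (K + 1), b k + (A * h (K + 1) + θ * b K) := by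
            gcongr; exact hsucc K
        _ = ((1 - θ) * ∑ k ∈ Finset.range (K + 1), b k + θ * b K) + A * h (K + 1) := by ring
        _ ≤ A * ∑ k ∈ Finset.range (K + 1), h k + A * h (K + 1) := by gcongr
        _ = _ := by rw [Finset.sum_range_succ _ (K + 1), mul_add]
  calc ∑ k ∈ Finset.range K, (1 - θ) * b k ≤ (1 - θ) * ∑ k ∈ Finset.range (K + 1), b k := by
        rw [← Finset.mul_sum]
        gcongr
        omega
    _ ≤ (1 - θ) * ∑ k ∈ Finset.range (K + 1), b k + θ * b K := le_self_add
    _ ≤ A * ∑ k ∈ Finset.range (K + 1), h k := key K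
    _ ≤ A * ∑' k, h k := by gcongr; exact ENNReal.sum_le_tsum _

open Classical in
/-- The potential built from `slowAvg` over the valid scales `n ≥ N`. -/
def slowPot (μ : Measure X) (β δ : ℝ) (L : ℕ) (F : X → ℝ≥0∞) (N : ℤ) (x : X) : ℝ≥0∞ :=
  ∑' n : ℤ, if N ≤ n ∧ validIdx X n then
    (2 : ℝ≥0∞) ^ (-β * (n : ℝ)) * slowAvg μ δ L F n x else 0

lemma slowPot_le_Hpot_runInc {μ : Measure X} {c : ℝ≥0∞} (hdbl : IsDoubling μ c)
    (hpos : ∀ (x : X) (r : ℝ), 0 < r → 0 < μ (ball x r))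
    (hfin : ∀ (x : X) (r : ℝ), μ (ball x r) ≠ ∞) (hc : c ≠ ∞)
    {β δ : ℝ} (hδ : 0 ≤ δ) (L : ℕ) (hθ : ENNReal.ofReal ((1 + δ) ^ L) ^ 2 * 2 ^ (-β) ≤ 1)
    (F : X → ℝ≥0∞) (N : ℤ) (x : X) :
    (1 - ENNReal.ofReal ((1 + δ) ^ L) ^ 2 * 2 ^ (-β)) * slowPot μ β δ L F N x ≤
      ENNReal.ofReal ((1 + δ) ^ L) * c * Hpot μ β (runInc μ δ L F N) x := by
  set lam := ENNReal.ofReal ((1 + δ) ^ L)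
  set w : ℤ → ℝ≥0∞ := fun n => (2 : ℝ≥0∞) ^ (-β * (n : ℝ)) with hw
  have hw_succ : ∀ n : ℤ, w n = 2 ^ (-β) * w (n - 1) := by
    intro n
    simp only [hw]
    rw [← ENNReal.rpow_add _ _ (by norm_num) (by norm_num)]
    push_cast
    ring_nf
  set b : ℕ → ℝ≥0∞ := fun k => w (N + k) * runSup μ δ L F N (N + k) x with hb
  set h : ℕ → ℝ≥0∞ := fun k => w (N + k) * ballAvg μ (N + k) (runInc μ δ L F N (N + k)) x with hh
  have hstep : ∀ n : ℤ, w n * runSup μ δ L F N n x ≤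
      lam * c * (w n * ballAvg μ n (runInc μ δ L F N n) x) +
        lam ^ 2 * 2 ^ (-β) * (w (n - 1) * runSup μ δ L F N (n - 1) x) := by
    intro n
    calc _ ≤ w n * (lam * c * ballAvg μ n (runInc μ δ L F N n) x +
          lam ^ 2 * runSup μ δ L F N (n - 1) x) := by
          gcongr
          exact runSup_le_ballAvg_add hdbl hpos hfin hc hδ L F N n x
      _ = lam * c * (w n * ballAvg μ n (runInc μ δ L F N n) x) +
          lam ^ 2 * (w n * runSup μ δ L F N (n - 1) x) := by ring
      _ = _ := by rw [hw_succ n]; ring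
  have hsum : (1 - lam ^ 2 * 2 ^ (-β)) * ∑' k, b k ≤ lam * c * ∑' k, h k := by
    refine one_sub_mul_tsum_le hθ ?_ fun k => ?_
    · have := hstep (N + (0 : ℕ))
      rwa [runSup_of_lt μ δ L F (n := N + (0 : ℕ) - 1) (by simp), mul_zero, mul_zero, add_zero]
        at this
    · have := hstep (N + (k + 1 : ℕ))
      rwa [show N + ((k + 1 : ℕ) : ℤ) - 1 = N + k by push_cast; ring] at this
  have hP : slowPot μ β δ L F N x ≤ ∑' k, b k := by
    classical
    rw [slowPot, ← (injective_add_natCast N).tsum_eq]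
    · refine ENNReal.tsum_le_tsum fun k => ?_
      split_ifs with hk
      · simp only [hb, hw]
        gcongr
        exact slowAvg_le_runSup μ δ L F hk.1 le_rfl hk.2 x
      · exact zero_le
    · intro n hn
      refine mem_range_add_natCast (not_lt.1 fun h => hn ?_)
      exact if_neg fun h' => (not_le.2 h) h'.1
  have hH : ∑' k, h k ≤ Hpot μ β (runInc μ δ L F N) x := by
    refine le_trans ?_ (ENNReal.tsum_comp_le_tsum_of_injective (injective_add_natCast N) _)
    refine ENNReal.tsum_le_tsum fun k => ?_
    by_cases hk : validIdx X (N + k)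
    · rw [if_pos hk]; exact le_rfl
    · have h0 : runInc μ δ L F N (N + k) = 0 :=
        funext fun y => runInc_of_not_validIdx μ δ L F N hk y
      simp [hh, h0, ballAvg]
  calc _ ≤ (1 - lam ^ 2 * 2 ^ (-β)) * ∑' k, b k := by gcongr
    _ ≤ lam * c * ∑' k, h k := hsum
    _ ≤ _ := by gcongr

omit [BorelSpace X] in
lemma exists_forall_le_slowPot (μ : Measure X) {β δ : ℝ} (hδ : 0 ≤ δ) (L : ℕ)
    {f : ℤ → X → ℝ≥0∞} {F : X → ℝ≥0∞} (hfF : ∀ n, f n ≤ F) {E : Set X} (hE : IsCompact E)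
    (hf : ∀ x ∈ E, 1 ≤ Hpot μ β f x) :
    ∃ N : ℤ, ∀ x ∈ E, 1 ≤ 2 * ENNReal.ofReal ((1 + δ) ^ L) ^ 2 * slowPot μ β δ L F N x := by
  classical
  set lam := ENNReal.ofReal ((1 + δ) ^ L)
  have hlam0 : lam ≠ 0 := (ENNReal.ofReal_pos.2 (by positivity)).ne'
  have hlamt : lam ≠ ∞ := ENNReal.ofReal_ne_top
  have hanti : ∀ {N N' : ℤ}, N ≤ N' → ∀ x, slowPot μ β δ L F N' x ≤ slowPot μ β δ L F N x := by
    intro N N' hN x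
    refine ENNReal.tsum_le_tsum fun n => ?_
    by_cases h : N' ≤ n ∧ validIdx X n
    · rw [if_pos h, if_pos ⟨hN.trans h.1, h.2⟩]
    · rw [if_neg h]; exact zero_le
  refine hE.induction_on
    (p := fun S => ∃ N : ℤ, ∀ x ∈ S, 1 ≤ 2 * lam ^ 2 * slowPot μ β δ L F N x)
    ⟨0, by simp⟩ (fun S T hST ⟨N, hN⟩ => ⟨N, fun x hx => hN x (hST hx)⟩) ?_ ?_
  · rintro S T ⟨N, hN⟩ ⟨N', hN'⟩
    refine ⟨min N N', fun x hx => ?_⟩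
    rcases hx with hx | hx
    · refine (hN x hx).trans ?_
      gcongr
      exact hanti (min_le_left _ _) x
    · refine (hN' x hx).trans ?_
      gcongr
      exact hanti (min_le_right _ _) x
  · intro x hx
    set t : X → ℤ → ℝ≥0∞ := fun y n =>
      if validIdx X n then (2 : ℝ≥0∞) ^ (-β * (n : ℝ)) * slowAvg μ δ L F n y else 0 with ht
    have h1 : 1 ≤ lam * ∑' n, t x n := by
      refine (hf x hx).trans ?_
      rw [Hpot, ← ENNReal.tsum_mul_left]
      refine ENNReal.tsum_le_tsum fun n => ?_
      simp only [ht]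
      split_ifs
      · rw [mul_left_comm]
        gcongr
        exact ballAvg_le_slowAvg μ hδ L (hfF n) n x
      · exact zero_le
    have h2 : (1 : ℝ≥0∞) < 2 * lam * ∑' n, t x n := by
      calc (1 : ℝ≥0∞) < 2 * 1 := by norm_num
        _ ≤ 2 * (lam * ∑' n, t x n) := by gcongr
        _ = _ := by ring
    obtain ⟨s, hs⟩ : ∃ s : Finset ℤ, 1 < 2 * lam * ∑ n ∈ s, t x n := by
      rw [ENNReal.tsum_eq_iSup_sum, ENNReal.mul_iSup] at h2
      exact lt_iSup_iff.1 h2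
    obtain ⟨N, hN⟩ := s.bddBelow
    obtain ⟨M, hM⟩ := s.bddAbove
    refine ⟨ball x (2 ^ (-M)), mem_nhdsWithin_of_mem_nhds (ball_mem_nhds x (by positivity)),
      N, fun y hy => hs.le.trans ?_⟩
    calc 2 * lam * ∑ n ∈ s, t x n ≤ 2 * lam * ∑ n ∈ s, lam * (if N ≤ n ∧ validIdx X n then
          (2 : ℝ≥0∞) ^ (-β * (n : ℝ)) * slowAvg μ δ L F n y else 0) := by
          gcongr with n hn
          simp only [ht]
          by_cases hv : validIdx X n
          · rw [if_pos hv, if_pos ⟨hN hn, hv⟩, mul_left_comm]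
            gcongr
            exact slowAvg_le_of_dist_le μ hδ L F (hM hn) (mem_ball'.1 hy).le
          · rw [if_neg hv]; exact zero_le
      _ = 2 * lam ^ 2 * ∑ n ∈ s, (if N ≤ n ∧ validIdx X n then
          (2 : ℝ≥0∞) ^ (-β * (n : ℝ)) * slowAvg μ δ L F n y else 0) := by
          rw [← Finset.mul_sum]; ring
      _ ≤ _ := by
          gcongr
          exact ENNReal.sum_le_tsum _

/-! ### Sequence norms -/

omit [BorelSpace X] in
lemma Hpot_const_mul (μ : Measure X) (β : ℝ) {D : ℝ≥0∞} (hD : D ≠ ∞) (g : ℤ → X → ℝ≥0∞) (x : X) :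
    Hpot μ β (fun n y => D * g n y) x = D * Hpot μ β g x := by
  classical
  rw [Hpot, Hpot, ← ENNReal.tsum_mul_left]
  refine tsum_congr fun n => ?_
  rw [mul_ite, mul_zero]
  congr 1
  rw [mul_left_comm, ← lintegral_const_mul' _ _ hD]
  congr 1
  refine lintegral_congr fun y => ?_
  rw [mul_left_comm, mul_div_assoc]

lemma le_lqNorm {τ : ℝ≥0∞} (hτ : τ ≠ 0) (a : ℤ → ℝ≥0∞) (k : ℤ) : a k ≤ lqNorm τ a := by
  rw [lqNorm]
  split_ifs with h
  · exact le_iSup a k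
  · have h0 : 0 < τ.toReal := ENNReal.toReal_pos hτ h
    rw [one_div, ENNReal.le_rpow_inv_iff h0]
    exact ENNReal.le_tsum k

lemma lqNorm_le_tsum {q : ℝ≥0∞} (hq : 1 ≤ q) (a : ℤ → ℝ≥0∞) : lqNorm q a ≤ ∑' k, a k := by
  rw [lqNorm]
  split_ifs with h
  · exact iSup_le fun k => ENNReal.le_tsum k
  have h1 : 1 ≤ q.toReal := by
    rw [← ENNReal.toReal_one]
    exact ENNReal.toReal_mono h hq
  have hpow : ∀ b : ℝ≥0∞, b ^ q.toReal = b * b ^ (q.toReal - 1) := fun b => by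
    nth_rw 2 [← ENNReal.rpow_one b]
    rw [← ENNReal.rpow_add_of_nonneg _ _ zero_le_one (by linarith), add_sub_cancel]
  rw [one_div, ENNReal.rpow_inv_le_iff (by linarith), hpow, ← ENNReal.tsum_mul_right]
  refine ENNReal.tsum_le_tsum fun k => ?_
  rw [hpow]
  gcongr
  exact ENNReal.le_tsum k

omit [MetricSpace X] [BorelSpace X] in
lemma mixedNorm_univ_rpow (μ : Measure X) {p : ℝ} (hp : p ≠ 0) (q : ℝ≥0∞) (g : ℤ → X → ℝ≥0∞) :
    mixedNorm μ univ p q g ^ p = ∫⁻ x, lqNorm q (fun k => g k x) ^ p ∂μ := by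
  rw [mixedNorm, one_div, ENNReal.rpow_inv_rpow hp, Measure.restrict_univ]

lemma exists_pow_mul_two_rpow_neg_lt_one {β : ℝ} (hβ : 0 < β) (L : ℕ) :
    ∃ δ : ℝ, 0 < δ ∧ δ ≤ 1 ∧ ENNReal.ofReal ((1 + δ) ^ L) ^ 2 * 2 ^ (-β) < 1 := by
  have hcont : ContinuousAt (fun δ : ℝ => ((1 + δ) ^ L) ^ 2 * (2 : ℝ) ^ (-β)) 0 := by fun_prop
  have h0 : ((1 + (0 : ℝ)) ^ L) ^ 2 * (2 : ℝ) ^ (-β) < 1 := by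
    simpa using Real.rpow_lt_one_of_one_lt_of_neg one_lt_two (neg_lt_zero.2 hβ)
  obtain ⟨ε, hε, hlt⟩ := Metric.eventually_nhds_iff.1 (hcont.eventually_lt_const h0)
  have hδ : 0 < min (ε / 2) 1 := by positivity
  refine ⟨min (ε / 2) 1, hδ, min_le_right _ _, ?_⟩
  have h := hlt (y := min (ε / 2) 1) (by
    rw [Real.dist_0_eq_abs, abs_of_pos hδ]
    exact (min_le_left _ _).trans_lt (half_lt_self hε))
  rw [← ENNReal.ofReal_pow (by positivity), ← ENNReal.ofReal_ofNat,
    ENNReal.ofReal_rpow_of_pos (by norm_num), ← ENNReal.ofReal_mul (by positivity)]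
  exact ENNReal.ofReal_lt_one.2 h

lemma exists_lt_two_pow {c : ℝ≥0∞} (hc : c ≠ ∞) : ∃ L : ℕ, c < 2 ^ L := by
  obtain ⟨n, hn⟩ := ENNReal.exists_nat_gt hc
  exact ⟨n, hn.trans (by exact_mod_cast n.lt_two_pow_self)⟩

theorem statement14
    (μ : Measure X) [Nontrivial X]
    (c_mu : ℝ≥0∞) (hc1 : 1 < c_mu) (hc2 : c_mu ≠ ∞) (hdbl : IsDoubling μ c_mu)
    (hpos : ∀ (x : X) (r : ℝ), 0 < r → 0 < μ (ball x r))
    (hfin : ∀ (x : X) (r : ℝ), μ (ball x r) ≠ ∞)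
    (c_sigma : ℝ≥0∞) (p β σ : ℝ) (hp : 1 < p) (hβ : 0 < β)
    (hσ : β < σ) (hcσ0 : 0 < c_sigma) (hcσ1 : c_sigma ≠ ∞) (hqrd : IsQRD μ σ c_sigma) :
    ∃ C : ℝ≥0∞, 0 < C ∧ C ≠ ∞ ∧
      ∀ (q τ : ℝ≥0∞), 1 ≤ q → 1 ≤ τ →
        ∀ E : Set X, IsCompact E →
          CpCap μ β p q E ≤ C * CpCap μ β p τ E := by
  have hc0 : c_mu ≠ 0 := (zero_lt_one.trans hc1).ne'
  have hp0 : 0 < p := by linarith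
  obtain ⟨L, hL⟩ := exists_lt_two_pow hc2
  obtain ⟨δ, hδ, hδ1, hθ⟩ := exists_pow_mul_two_rpow_neg_lt_one hβ L
  set lam := ENNReal.ofReal ((1 + δ) ^ L)
  have hlamt : lam ≠ ∞ := ENNReal.ofReal_ne_top
  set ε := 1 - lam ^ 2 * 2 ^ (-β) with hε
  have hε0 : ε ≠ 0 := (tsub_pos_iff_lt.2 hθ).ne'
  have hεt : ε ≠ ∞ := ne_top_of_le_ne_top ENNReal.one_ne_top tsub_le_self
  set D := 2 * lam ^ 2 * (ε⁻¹ * (lam * c_mu)) with hD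
  have hDt : D ≠ ∞ := by finiteness
  set M := (slowConst c_mu δ L * 2) ^ p * (2 * c_mu ^ 3) * (1 - 2 ^ (-(p - 1)))⁻¹ *
    2 ^ (p - 1)
  have hMt : M ≠ ∞ := by
    have h1 := slowConst_ne_top hc2 δ hL
    have h2 : (1 - (2 : ℝ≥0∞) ^ (-(p - 1))) ≠ 0 := by
      refine (tsub_pos_iff_lt.2 ?_).ne'
      exact ENNReal.rpow_lt_one_of_one_lt_of_neg (by norm_num) (by linarith)
    finiteness
  refine ⟨D ^ p * M + 1, by positivity, by finiteness, fun q τ hq hτ E hE => ?_⟩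
  rw [CpCap, CpCap, ENNReal.mul_iInf_of_ne (by positivity) (by finiteness)]
  refine le_iInf fun ⟨f, ⟨hfm, hf0⟩, hfE⟩ => ?_
  set F : X → ℝ≥0∞ := fun x => ⨆ n, f n x with hF
  have hFm : Measurable F := Measurable.iSup hfm
  have hfF : ∀ n, f n ≤ F := fun n x => le_iSup (fun n => f n x) n
  obtain ⟨N, hN⟩ := exists_forall_le_slowPot μ hδ.le L hfF hE hfE
  set g : ℤ → X → ℝ≥0∞ := fun n x => D * runInc μ δ L F N n x with hg
  have hgadm : IsAdmissibleSeq g := by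
    refine ⟨fun n => (measurable_runInc μ hδ.le L F N n).const_mul D, fun n hn => ?_⟩
    funext x
    simp [hg, runInc_of_not_validIdx μ δ L F N hn x]
  have hgE : ∀ x ∈ E, 1 ≤ Hpot μ β g x := by
    intro x hx
    have h := slowPot_le_Hpot_runInc hdbl hpos hfin hc2 hδ.le L hθ.le F N x
    rw [mul_comm, ← ENNReal.le_div_iff_mul_le (Or.inl hε0) (Or.inl hεt), div_eq_mul_inv] at h
    calc 1 ≤ 2 * lam ^ 2 * slowPot μ β δ L F N x := hN x hx
      _ ≤ 2 * lam ^ 2 * (lam * c_mu * Hpot μ β (runInc μ δ L F N) x * ε⁻¹) := by gcongr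
      _ = D * Hpot μ β (runInc μ δ L F N) x := by rw [hD]; ring
      _ = Hpot μ β g x := (Hpot_const_mul μ β hDt _ x).symm
  refine iInf_le_of_le ⟨g, hgadm, hgE⟩ ?_
  rw [mixedNorm_univ_rpow μ hp0.ne', mixedNorm_univ_rpow μ hp0.ne']
  calc ∫⁻ x, lqNorm q (fun k => g k x) ^ p ∂μ
      ≤ ∫⁻ x, D ^ p * (⨆ m, slowAvg μ δ L F m x) ^ p ∂μ := by
        refine lintegral_mono fun x => ?_
        rw [← ENNReal.mul_rpow_of_nonneg _ _ hp0.le]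
        gcongr
        refine (lqNorm_le_tsum hq _).trans ?_
        rw [ENNReal.tsum_mul_left]
        gcongr
        exact tsum_runInc_le μ δ L F N x
    _ = D ^ p * ∫⁻ x, (⨆ m, slowAvg μ δ L F m x) ^ p ∂μ :=
        lintegral_const_mul' _ _ (by finiteness)
    _ ≤ D ^ p * (M * ∫⁻ x, F x ^ p ∂μ) := by
        gcongr
        exact lintegral_iSup_slowAvg_rpow_le hdbl hpos hfin hc0 hc2 hp hδ hδ1 hL hFm
    _ ≤ (D ^ p * M + 1) * ∫⁻ x, lqNorm τ (fun k => f k x) ^ p ∂μ := by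
        rw [← mul_assoc]
        gcongr
        · exact le_self_add
        · exact iSup_le fun k => le_lqNorm (zero_lt_one.trans_le hτ).ne' _ k

end TLCap

end
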